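/- Fix row vectors Ψ^{(s)(L,t)} ∈ ℝ^{1 × n_L} and matrices Ψ^{(s,0)(L,t)} ∈ ℝ^{n_0 × n_L} for all L ≥ s > 0, L > t ≥ 0. For a collection Φ of real coefficients Φ_{(s,t):pq} (L ≥ s > t ≥ 0), Φ_{(s):p} (L ≥ s > 0), Φ_{(s,t)(t):p} (L ≥ s > t > 0), Φ_{(s)(L,t):pq}, Φ_{(s,0)(L,t):pq} (L ≥ s > 0, L > t ≥ 0), Φ_1, let α(Φ, Ψ) := Σ_{L≥s>t≥0} Σ_{p,q} Φ_{(s,t):pq}·𝐖^(s,t)_{pq} + Σ_{L≥s>0} Σ_p Φ_{(s):p}·𝐛^(s)_p + Σ_{L≥s>t>0} Σ_p Φ_{(s,t)(t):p}·(𝐖^(s,t)·𝐛^(t))_p + Σ_{L≥s>0, L>t≥0} Σ_{p,q} Φ_{(s)(L,t):pq}·(𝐛^(s)·Ψ^{(s)(L,t)}·𝐖^(L,t))_{pq} + Σ_{L≥s>0, L>t≥0} Σ_{p,q} Φ_{(s,0)(L,t):pq}·(𝐖^(s,0)·Ψ^{(s,0)(L,t)}·𝐖^(L,t))_{pq} +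 Φ_1 ∈ R. If two such collections Φ and Φ' satisfy α(Φ, Ψ) = α(Φ', Ψ), then: (1) Φ_{(s,t):pq} = Φ'_{(s,t):pq} for all (s,t) ≠ (L,0) and all p, q; (2) for s ≠ t, either Φ_{(s,0)(L,t):pq} = Φ'_{(s,0)(L,t):pq} for all p, q, or Ψ^{(s,0)(L,t)} = 0; (3) Σ_{p,q} Φ_{(L,0):pq}·𝐖^(L,0)_{pq} + Σ_{L>s>0} Σ_{p,q} Φ_{(s,0)(L,s):pq}·(𝐖^(s,0)·Ψ^{(s,0)(L,s)}·𝐖^(L,s))_{pq} equals the same expression with Φ replaced by Φ'; (4) Φ_{(s,t)(t):p} = Φ'_{(s,t)(t):p} for all L > s > t > 0 and all p; (5) for s ≠ t, either Φ_{(s)(L,t):pq} = Φ'_{(s)(L,t):pq} for all p, q, or Ψ^{(s)(L,t)} = 0; (6) for all L > t > 0, Σ_p Φ_{(L,t)(t):p}·(𝐖^(L,t)·𝐛^(t))_p + Σ_{p,q} Φ_{(t)(L,t):pq}·(𝐛^(t)·Ψ^{(t)(L,t)}·𝐖^(L,t))_{pq} equals the same expression with Φ replaced by Φ'; (7) Φ_{(s):p}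 = Φ'_{(s):p} for all s, p; (8) Φ_1 = Φ'_1. -/

import Mathlib

open Matrix MvPolynomial

noncomputable section

/-- Indeterminates: `Sum.inl (i, j, k)` is `x^(i)_{jk}` and `Sum.inr (i, j)` is `y^(i)_j`. -/
abbrev PVar : Type := (ℕ × ℕ × ℕ) ⊕ (ℕ × ℕ)

/-- The polynomial ring `R` with real coefficients in the indeterminates
`x^(i)_{jk}` and `y^(i)_j`. -/
abbrev Rpoly : Type := MvPolynomial PVar ℝ

/-- The matrix `𝐖^(i)` of indeterminates, with `(j,k)` entry `x^(i)_{jk}`. -/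
def Wm (n : ℕ → ℕ) (i : ℕ) : Matrix (Fin (n i)) (Fin (n (i - 1))) Rpoly :=
  Matrix.of fun j k => MvPolynomial.X (Sum.inl (i, (j : ℕ), (k : ℕ)))

/-- The column vector `𝐛^(i)` of indeterminates, with `j`-th entry `y^(i)_j`. -/
def bm (n : ℕ → ℕ) (i : ℕ) : Matrix (Fin (n i)) (Fin 1) Rpoly :=
  Matrix.of fun j _ => MvPolynomial.X (Sum.inr (i, (j : ℕ)))

/-- The product `𝐖^(s,t) = 𝐖^(s) * 𝐖^(s-1) * ⋯ * 𝐖^(t+1)` of `s - t` matrices. -/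
def WmProd (n : ℕ → ℕ) : (s : ℕ) → (t : ℕ) → Matrix (Fin (n s)) (Fin (n t)) Rpoly
  | s, t =>
    if _h : t < s then Wm n s * WmProd n (s - 1) t
    else Matrix.of fun i j => if (i : ℕ) = (j : ℕ) then (1 : Rpoly) else 0
termination_by s t => s
decreasing_by omega

/-- The entrywise inclusion of a real matrix into matrices over `R`. -/
def toR {m k : Type*} (M : Matrix m k ℝ) : Matrix m k Rpoly :=
  M.map (MvPolynomial.C)

/-- The polynomial `α(Φ, Ψ)`: the general linear combination of all stable polynomial terms. -/
def alphaPoly (L : ℕ) (n : ℕ → ℕ)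
    (Ψb : ∀ _s _t : ℕ, Matrix (Fin 1) (Fin (n L)) ℝ)
    (ΨW : ∀ _s _t : ℕ, Matrix (Fin (n 0)) (Fin (n L)) ℝ)
    (Φst : ∀ s t : ℕ, Fin (n s) → Fin (n t) → ℝ)
    (Φb : ∀ s : ℕ, Fin (n s) → ℝ)
    (ΦWb : ∀ s _t : ℕ, Fin (n s) → ℝ)
    (ΦbW : ∀ s t : ℕ, Fin (n s) → Fin (n t) → ℝ)
    (ΦWW : ∀ s t : ℕ, Fin (n s) → Fin (n t) → ℝ)
    (Φ1 : ℝ) : Rpoly :=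
  (∑ s ∈ Finset.Icc 1 L, ∑ t ∈ Finset.range s, ∑ p, ∑ q,
      MvPolynomial.C (Φst s t p q) * (WmProd n s t) p q)
  + (∑ s ∈ Finset.Icc 1 L, ∑ p, MvPolynomial.C (Φb s p) * (bm n s) p 0)
  + (∑ s ∈ Finset.Icc 1 L, ∑ t ∈ Finset.Ioo 0 s, ∑ p,
      MvPolynomial.C (ΦWb s t p) * (WmProd n s t * bm n t) p 0)
  + (∑ s ∈ Finset.Icc 1 L, ∑ t ∈ Finset.range L, ∑ p, ∑ q,
      MvPolynomial.C (ΦbW s t p q) * (bm n s * toR (Ψb s t) * WmProd n L t) p q)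
  + (∑ s ∈ Finset.Icc 1 L, ∑ t ∈ Finset.range L, ∑ p, ∑ q,
      MvPolynomial.C (ΦWW s t p q) * (WmProd n s 0 * toR (ΨW s t) * WmProd n L t) p q)
  + MvPolynomial.C Φ1

/-- The degree that is one exactly in the layers `t + 1, …, s`. -/
def intervalDegree (t s : ℕ) : ℕ → ℕ := fun i => if t < i ∧ i ≤ s then 1 else 0

/-- The grading that records the layers of the weight variables and of the bias variables. -/
def layerWeight : PVar → (ℕ → ℕ) × (ℕ → ℕ)
  | Sum.inl (i, _, _) => (Pi.single i 1, 0)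
  | Sum.inr (i, _) => (0, Pi.single i 1)

theorem intervalDegree_eq_iff {t s t' s' : ℕ} (h : t < s) (h' : t' < s') :
    intervalDegree t s = intervalDegree t' s' ↔ s' = s ∧ t' = t := by
  refine ⟨fun e => ?_, fun ⟨e₁, e₂⟩ => by rw [e₁, e₂]⟩
  have e : ∀ i, intervalDegree t s i = intervalDegree t' s' i := congrFun e
  have e₁ := e s
  have e₂ := e s'
  have e₃ := e (t + 1)
  have e₄ := e (t' + 1)
  simp only [intervalDegree] at e₁ e₂ e₃ e₄
  grind

theorem intervalDegree_eq_add_iff {L t s t' s' : ℕ} (h : t < s) (hs' : 0 < s') (hs'L : s' ≤ L)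
    (ht' : t' < L) :
    intervalDegree t s = intervalDegree 0 s' + intervalDegree t' L ↔
      s' = t' ∧ s = L ∧ t = 0 := by
  refine ⟨fun e => ?_, fun ⟨e₁, e₂, e₃⟩ => ?_⟩
  · have e : ∀ i, intervalDegree t s i = intervalDegree 0 s' i + intervalDegree t' L i := congrFun e
    have e₁ := e L
    have e₂ := e 1
    have e₃ := e s'
    have e₄ := e (s' + 1)
    have e₅ := e s
    have e₆ := e t
    simp only [intervalDegree] at e₁ e₂ e₃ e₄ e₅ e₆
    grind
  · subst e₁ e₂ e₃
    funext i
    simp only [intervalDegree, Pi.add_apply]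
    grind

theorem intervalDegree_add_eq_add_iff {L t s t' s' : ℕ} (hs : 0 < s) (hsL : s ≤ L) (ht : t < L)
    (hs' : 0 < s') (hs'L : s' ≤ L) (ht' : t' < L) (hst : s ≠ t) :
    intervalDegree 0 s + intervalDegree t L = intervalDegree 0 s' + intervalDegree t' L ↔
      s' = s ∧ t' = t := by
  refine ⟨fun e => ?_, fun ⟨e₁, e₂⟩ => by rw [e₁, e₂]⟩
  have e : ∀ i, intervalDegree 0 s i + intervalDegree t L i
      = intervalDegree 0 s' i + intervalDegree t' L i := congrFun e
  have e₁ := e s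
  have e₂ := e s'
  have e₃ := e (s + 1)
  have e₄ := e (s' + 1)
  have e₅ := e t
  have e₆ := e t'
  have e₇ := e (t + 1)
  have e₈ := e (t' + 1)
  simp only [intervalDegree] at e₁ e₂ e₃ e₄ e₅ e₆ e₇ e₈
  grind

theorem intervalDegree_ne_zero {t s : ℕ} (h : t < s) : intervalDegree t s ≠ 0 := by
  intro e
  have := congrFun e s
  simp [intervalDegree, h] at this

theorem single_one_inj {i j : ℕ} : (Pi.single i 1 : ℕ → ℕ) = Pi.single j 1 ↔ j = i := by
  refine ⟨fun e => ?_, fun e => by rw [e]⟩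
  have := congrFun e i
  by_contra hne
  simp [Ne.symm hne] at this

@[simp]
theorem zero_ne_single_one (i : ℕ) : (0 : ℕ → ℕ) ≠ Pi.single i 1 := by
  simp [eq_comm]

theorem WmProd_self (n : ℕ → ℕ) (s : ℕ) : WmProd n s s = 1 := by
  rw [WmProd]
  ext i j
  simp [Matrix.one_apply, Fin.ext_iff]

theorem WmProd_succ_apply (n : ℕ → ℕ) {s t : ℕ} (h : t ≤ s) (p : Fin (n (s + 1)))
    (q : Fin (n t)) :
    WmProd n (s + 1) t p q = ∑ k : Fin (n s), Wm n (s + 1) p k * WmProd n s t k q := by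
  rw [WmProd, dif_pos (Nat.lt_succ_of_le h)]
  rfl

theorem WmProd_isWeightedHomogeneous (n : ℕ → ℕ) {s t : ℕ} (h : t ≤ s) (p : Fin (n s))
    (q : Fin (n t)) :
    IsWeightedHomogeneous layerWeight (WmProd n s t p q) (intervalDegree t s, 0) := by
  induction s, h using Nat.le_induction with
  | base =>
    have e : (intervalDegree t t, 0) = (0 : (ℕ → ℕ) × (ℕ → ℕ)) := by
      refine Prod.ext (funext fun i => ?_) rfl
      simp only [intervalDegree, Prod.fst_zero, Pi.zero_apply]
      grind
    rw [WmProd_self, Matrix.one_apply, e]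
    split_ifs
    · exact isWeightedHomogeneous_one ℝ _
    · exact isWeightedHomogeneous_zero ℝ _ _
  | succ s hs ih =>
    have e : (intervalDegree t (s + 1), (0 : ℕ → ℕ))
        = (Pi.single (s + 1) 1, 0) + (intervalDegree t s, 0) := by
      refine Prod.ext (funext fun i => ?_) (by simp)
      simp only [intervalDegree, Prod.mk_add_mk, Pi.add_apply, Pi.single_apply]
      grind
    rw [WmProd_succ_apply n hs, e]
    exact IsWeightedHomogeneous.sum _ _ _ fun k _ =>
      (isWeightedHomogeneous_X ℝ layerWeight _).mul (ih k)

/-- The linear combination of the entries of `M` with coefficients `D`. -/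
def entrySum {a b : ℕ} (D : Fin a → Fin b → ℝ) (M : Matrix (Fin a) (Fin b) Rpoly) : Rpoly :=
  ∑ p, ∑ q, MvPolynomial.C (D p q) * M p q

/-- The linear combination of the entries of the column `M` with coefficients `D`. -/
def columnSum {a : ℕ} (D : Fin a → ℝ) (M : Matrix (Fin a) (Fin 1) Rpoly) : Rpoly :=
  ∑ p, MvPolynomial.C (D p) * M p 0

section Homogeneous

variable {a b : ℕ} {d e : (ℕ → ℕ) × (ℕ → ℕ)}

theorem entrySum_isWeightedHomogeneous (D : Fin a → Fin b → ℝ)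
    {M : Matrix (Fin a) (Fin b) Rpoly}
    (h : ∀ p q, IsWeightedHomogeneous layerWeight (M p q) d) :
    IsWeightedHomogeneous layerWeight (entrySum D M) d :=
  .sum _ _ _ fun p _ => .sum _ _ _ fun q _ => (h p q).C_mul _

theorem columnSum_isWeightedHomogeneous (D : Fin a → ℝ) {M : Matrix (Fin a) (Fin 1) Rpoly}
    (h : ∀ p q, IsWeightedHomogeneous layerWeight (M p q) d) :
    IsWeightedHomogeneous layerWeight (columnSum D M) d :=
  .sum _ _ _ fun p _ => (h p 0).C_mul _

theorem matrix_mul_isWeightedHomogeneous {l m k : ℕ} {M : Matrix (Fin l) (Fin m) Rpoly}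
    {N : Matrix (Fin m) (Fin k) Rpoly}
    (hM : ∀ p q, IsWeightedHomogeneous layerWeight (M p q) d)
    (hN : ∀ p q, IsWeightedHomogeneous layerWeight (N p q) e) (p : Fin l) (q : Fin k) :
    IsWeightedHomogeneous layerWeight ((M * N) p q) (d + e) := by
  rw [Matrix.mul_apply]
  exact .sum _ _ _ fun j _ => (hM p j).mul (hN j q)

theorem mul_toR_mul_isWeightedHomogeneous {l m k r : ℕ} {M : Matrix (Fin l) (Fin m) Rpoly}
    (A : Matrix (Fin m) (Fin k) ℝ) {N : Matrix (Fin k) (Fin r) Rpoly}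
    (hM : ∀ p q, IsWeightedHomogeneous layerWeight (M p q) d)
    (hN : ∀ p q, IsWeightedHomogeneous layerWeight (N p q) e) (p : Fin l) (q : Fin r) :
    IsWeightedHomogeneous layerWeight ((M * toR A * N) p q) (d + e) := by
  refine matrix_mul_isWeightedHomogeneous (fun p q => ?_) hN p q
  rw [← add_zero d]
  exact matrix_mul_isWeightedHomogeneous hM (fun p q => isWeightedHomogeneous_C _ _) p q

theorem bm_isWeightedHomogeneous (n : ℕ → ℕ) (s : ℕ) (p : Fin (n s)) (q : Fin 1) :
    IsWeightedHomogeneous layerWeight (bm n s p q) (0, Pi.single s 1) :=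
  isWeightedHomogeneous_X ℝ layerWeight _

end Homogeneous

section DoubleSum

variable {A : Finset ℕ} {B : ℕ → Finset ℕ} {P : ℕ → ℕ → Prop} [∀ s t, Decidable (P s t)]
  {f : ℕ → ℕ → Rpoly}

theorem sum_sum_ite_eq_single {s₀ t₀ : ℕ} (hs₀ : s₀ ∈ A) (ht₀ : t₀ ∈ B s₀)
    (hP : ∀ s ∈ A, ∀ t ∈ B s, (P s t ↔ s = s₀ ∧ t = t₀)) :
    ∑ s ∈ A, ∑ t ∈ B s, (if P s t then f s t else 0) = f s₀ t₀ := by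
  rw [Finset.sum_eq_single_of_mem s₀ hs₀, Finset.sum_eq_single_of_mem t₀ ht₀]
  · rw [if_pos ((hP s₀ hs₀ t₀ ht₀).2 ⟨rfl, rfl⟩)]
  · exact fun t ht hne => if_neg fun h => hne ((hP _ hs₀ t ht).1 h).2
  · exact fun s hs hne => Finset.sum_eq_zero fun t ht => if_neg fun h => hne ((hP s hs t ht).1 h).1

theorem sum_sum_ite_eq_zero (hP : ∀ s ∈ A, ∀ t ∈ B s, ¬ P s t) :
    ∑ s ∈ A, ∑ t ∈ B s, (if P s t then f s t else 0) = 0 :=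
  Finset.sum_eq_zero fun s hs => Finset.sum_eq_zero fun t ht => if_neg (hP s hs t ht)

end DoubleSum

theorem alphaPoly_sub (L : ℕ) (n : ℕ → ℕ)
    (Ψb : ∀ _s _t : ℕ, Matrix (Fin 1) (Fin (n L)) ℝ)
    (ΨW : ∀ _s _t : ℕ, Matrix (Fin (n 0)) (Fin (n L)) ℝ)
    (Φst Φst' : ∀ s t : ℕ, Fin (n s) → Fin (n t) → ℝ)
    (Φb Φb' : ∀ s : ℕ, Fin (n s) → ℝ)
    (ΦWb ΦWb' : ∀ s _t : ℕ, Fin (n s) → ℝ)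
    (ΦbW ΦbW' : ∀ s t : ℕ, Fin (n s) → Fin (n t) → ℝ)
    (ΦWW ΦWW' : ∀ s t : ℕ, Fin (n s) → Fin (n t) → ℝ)
    (Φ1 Φ1' : ℝ) :
    alphaPoly L n Ψb ΨW (Φst - Φst') (Φb - Φb') (ΦWb - ΦWb') (ΦbW - ΦbW') (ΦWW - ΦWW')
        (Φ1 - Φ1')
      = alphaPoly L n Ψb ΨW Φst Φb ΦWb ΦbW ΦWW Φ1
        - alphaPoly L n Ψb ΨW Φst' Φb' ΦWb' ΦbW' ΦWW' Φ1' := by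
  simp only [alphaPoly, Pi.sub_apply, map_sub, sub_mul, Finset.sum_sub_distrib]
  ring

section Component

variable {L : ℕ} {n : ℕ → ℕ}
    {Ψb : ∀ _s _t : ℕ, Matrix (Fin 1) (Fin (n L)) ℝ}
    {ΨW : ∀ _s _t : ℕ, Matrix (Fin (n 0)) (Fin (n L)) ℝ}
    {Φst : ∀ s t : ℕ, Fin (n s) → Fin (n t) → ℝ}
    {Φb : ∀ s : ℕ, Fin (n s) → ℝ}
    {ΦWb : ∀ s _t : ℕ, Fin (n s) → ℝ}
    {ΦbW : ∀ s t : ℕ, Fin (n s) → Fin (n t) → ℝ}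
    {ΦWW : ∀ s t : ℕ, Fin (n s) → Fin (n t) → ℝ}
    {Φ1 : ℝ}

open Classical in
theorem component_sum_eq_zero
    (h : alphaPoly L n Ψb ΨW Φst Φb ΦWb ΦbW ΦWW Φ1 = 0) (d : (ℕ → ℕ) × (ℕ → ℕ))
    {T₁ T₂ T₃ T₄ T₅ T₆ : Rpoly}
    (h₁ : ∑ s ∈ Finset.Icc 1 L, ∑ t ∈ Finset.range s,
      (if d = (intervalDegree t s, 0) then entrySum (Φst s t) (WmProd n s t) else 0) = T₁)
    (h₂ : ∑ s ∈ Finset.Icc 1 L,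
      (if d = (0, Pi.single s 1) then columnSum (Φb s) (bm n s) else 0) = T₂)
    (h₃ : ∑ s ∈ Finset.Icc 1 L, ∑ t ∈ Finset.Ioo 0 s,
      (if d = (intervalDegree t s, Pi.single t 1) then
        columnSum (ΦWb s t) (WmProd n s t * bm n t) else 0) = T₃)
    (h₄ : ∑ s ∈ Finset.Icc 1 L, ∑ t ∈ Finset.range L,
      (if d = (intervalDegree t L, Pi.single s 1) then
        entrySum (ΦbW s t) (bm n s * toR (Ψb s t) * WmProd n L t) else 0) = T₄)
    (h₅ : ∑ s ∈ Finset.Icc 1 L, ∑ t ∈ Finset.range L,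
      (if d = (intervalDegree 0 s + intervalDegree t L, 0) then
        entrySum (ΦWW s t) (WmProd n s 0 * toR (ΨW s t) * WmProd n L t) else 0) = T₅)
    (h₆ : (if d = 0 then MvPolynomial.C Φ1 else 0) = T₆) :
    T₁ + T₂ + T₃ + T₄ + T₅ + T₆ = 0 := by
  have key := congrArg (weightedHomogeneousComponent layerWeight d) h
  rw [map_zero, alphaPoly] at key
  simp only [map_add, map_sum (weightedHomogeneousComponent layerWeight d) _ (Finset.Icc _ _),
    map_sum (weightedHomogeneousComponent layerWeight d) _ (Finset.Ioo _ _),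
    map_sum (weightedHomogeneousComponent layerWeight d) _ (Finset.range _)] at key
  rw [← key, ← h₁, ← h₂, ← h₃, ← h₄, ← h₅, ← h₆]
  refine congr_arg₂ _ (congr_arg₂ _ (congr_arg₂ _ (congr_arg₂ _ (congr_arg₂ _ ?_ ?_) ?_) ?_) ?_) ?_
  · refine Finset.sum_congr rfl fun s _ => Finset.sum_congr rfl fun t ht => ?_
    exact (weightedHomogeneousComponent_of_mem (entrySum_isWeightedHomogeneous _
      (WmProd_isWeightedHomogeneous n (Finset.mem_range.1 ht).le))).symm
  · refine Finset.sum_congr rfl fun s _ => ?_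
    exact (weightedHomogeneousComponent_of_mem (columnSum_isWeightedHomogeneous _
      (bm_isWeightedHomogeneous n s))).symm
  · refine Finset.sum_congr rfl fun s _ => Finset.sum_congr rfl fun t ht => ?_
    have := columnSum_isWeightedHomogeneous (ΦWb s t) (matrix_mul_isWeightedHomogeneous
      (WmProd_isWeightedHomogeneous n (Finset.mem_Ioo.1 ht).2.le) (bm_isWeightedHomogeneous n t))
    simp only [Prod.mk_add_mk, add_zero, zero_add] at this
    exact (weightedHomogeneousComponent_of_mem this).symm
  · refine Finset.sum_congr rfl fun s _ => Finset.sum_congr rfl fun t ht => ?_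
    have := entrySum_isWeightedHomogeneous (ΦbW s t) (mul_toR_mul_isWeightedHomogeneous (Ψb s t)
      (bm_isWeightedHomogeneous n s)
      (WmProd_isWeightedHomogeneous n (Finset.mem_range.1 ht).le))
    simp only [Prod.mk_add_mk, add_zero, zero_add] at this
    exact (weightedHomogeneousComponent_of_mem this).symm
  · refine Finset.sum_congr rfl fun s _ => Finset.sum_congr rfl fun t ht => ?_
    have := entrySum_isWeightedHomogeneous (ΦWW s t) (mul_toR_mul_isWeightedHomogeneous (ΨW s t)
      (WmProd_isWeightedHomogeneous n s.zero_le)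
      (WmProd_isWeightedHomogeneous n (Finset.mem_range.1 ht).le))
    simp only [Prod.mk_add_mk, add_zero] at this
    exact (weightedHomogeneousComponent_of_mem this).symm
  · exact (weightedHomogeneousComponent_of_mem (isWeightedHomogeneous_C _ _)).symm

theorem entrySum_WmProd_eq_zero (h : alphaPoly L n Ψb ΨW Φst Φb ΦWb ΦbW ΦWW Φ1 = 0)
    {s t : ℕ} (hts : t < s) (hsL : s ≤ L) (hne : ¬(s = L ∧ t = 0)) :
    entrySum (Φst s t) (WmProd n s t) = 0 := by
  classical
  have key := component_sum_eq_zero h (intervalDegree t s, 0)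
    (sum_sum_ite_eq_single (s₀ := s) (t₀ := t) (by simp; omega) (by simpa) ?_)
    (Finset.sum_eq_zero fun i _ => if_neg (by simp)) (sum_sum_ite_eq_zero ?_)
    (sum_sum_ite_eq_zero ?_) (sum_sum_ite_eq_zero ?_)
    (if_neg (by simpa using intervalDegree_ne_zero hts))
  · simpa using key
  · intro s' hs' t' ht'
    simp only [Prod.mk.injEq, and_true]
    exact intervalDegree_eq_iff hts (Finset.mem_range.1 ht')
  · simp
  · simp
  · intro s' hs' t' ht'
    simp only [Finset.mem_Icc, Finset.mem_range] at hs' ht'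
    simp only [Prod.mk.injEq, and_true, intervalDegree_eq_add_iff hts hs'.1 hs'.2 ht']
    tauto

theorem entrySum_WmProd_mul_WmProd_eq_zero (h : alphaPoly L n Ψb ΨW Φst Φb ΦWb ΦbW ΦWW Φ1 = 0)
    {s t : ℕ} (hs : 0 < s) (hsL : s ≤ L) (ht : t < L)
    (hst : s ≠ t) : entrySum (ΦWW s t) (WmProd n s 0 * toR (ΨW s t) * WmProd n L t) = 0 := by
  classical
  have key := component_sum_eq_zero h (intervalDegree 0 s + intervalDegree t L, 0)
    (sum_sum_ite_eq_zero ?_)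
    (Finset.sum_eq_zero fun i _ => if_neg (by simp)) (sum_sum_ite_eq_zero ?_)
    (sum_sum_ite_eq_zero ?_)
    (sum_sum_ite_eq_single (s₀ := s) (t₀ := t) (by simp; omega) (by simpa) ?_)
    (if_neg ?_)
  · simpa using key
  · intro s' hs' t' ht'
    simp only [Prod.mk.injEq, and_true]
    rw [eq_comm, intervalDegree_eq_add_iff (Finset.mem_range.1 ht') hs hsL ht]
    tauto
  · simp
  · simp
  · intro s' hs' t' ht'
    simp only [Finset.mem_Icc, Finset.mem_range] at hs' ht'
    simp only [Prod.mk.injEq, and_true]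
    exact intervalDegree_add_eq_add_iff hs hsL ht hs'.1 hs'.2 ht' hst
  · simp only [Prod.mk_eq_zero, and_true, add_eq_zero]
    exact fun e => intervalDegree_ne_zero hs e.1

theorem entrySum_full_add_sum_eq_zero (h : alphaPoly L n Ψb ΨW Φst Φb ΦWb ΦbW ΦWW Φ1 = 0)
    (hL : 1 ≤ L) :
    entrySum (Φst L 0) (WmProd n L 0) + ∑ s ∈ Finset.Ioo 0 L,
      entrySum (ΦWW s s) (WmProd n s 0 * toR (ΨW s s) * WmProd n L s) = 0 := by
  classical
  have key := component_sum_eq_zero h (intervalDegree 0 L, 0)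
    (sum_sum_ite_eq_single (s₀ := L) (t₀ := 0) (by simp; omega) (by simpa) ?_)
    (Finset.sum_eq_zero fun i _ => if_neg (by simp)) (sum_sum_ite_eq_zero ?_)
    (sum_sum_ite_eq_zero ?_)
    (T₅ := ∑ s ∈ Finset.Ioo 0 L,
      entrySum (ΦWW s s) (WmProd n s 0 * toR (ΨW s s) * WmProd n L s)) ?_
    (if_neg (by simpa using intervalDegree_ne_zero hL))
  · simpa using key
  · intro s' hs' t' ht'
    simp only [Prod.mk.injEq, and_true]
    exact intervalDegree_eq_iff hL (Finset.mem_range.1 ht')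
  · simp
  · simp
  · have e : ∀ s ∈ Finset.Icc 1 L, ∀ t ∈ Finset.range L,
        ((intervalDegree 0 L, (0 : ℕ → ℕ)) = (intervalDegree 0 s + intervalDegree t L, 0)
          ↔ s = t) := by
      intro s hs t ht
      simp only [Finset.mem_Icc, Finset.mem_range] at hs ht
      simp [intervalDegree_eq_add_iff hL hs.1 hs.2 ht]
    rw [← Finset.sum_subset (s₁ := Finset.Ioo 0 L)]
    · refine Finset.sum_congr rfl fun s hs => ?_
      rw [Finset.mem_Ioo] at hs
      rw [Finset.sum_eq_single_of_mem s (Finset.mem_range.2 hs.2),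
        if_pos ((e s (by simp; omega) s (by simpa using hs.2)).2 rfl)]
      exact fun t ht hne => if_neg fun hd => hne ((e s (by simp; omega) t ht).1 hd).symm
    · intro s
      simp only [Finset.mem_Ioo, Finset.mem_Icc]
      omega
    · refine fun s hs hs' => Finset.sum_eq_zero fun t ht => if_neg fun hd => hs' ?_
      have := (e s hs t ht).1 hd
      simp only [Finset.mem_Ioo, Finset.mem_Icc, Finset.mem_range] at hs ht ⊢
      omega

theorem columnSum_WmProd_mul_bm_eq_zero (h : alphaPoly L n Ψb ΨW Φst Φb ΦWb ΦbW ΦWW Φ1 = 0)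
    {s t : ℕ} (hsL : s < L) (hts : t < s) (ht : 0 < t) :
    columnSum (ΦWb s t) (WmProd n s t * bm n t) = 0 := by
  classical
  have key := component_sum_eq_zero h (intervalDegree t s, Pi.single t 1)
    (sum_sum_ite_eq_zero ?_)
    (Finset.sum_eq_zero fun i _ => if_neg (by simp [intervalDegree_ne_zero hts]))
    (sum_sum_ite_eq_single (s₀ := s) (t₀ := t) (by simp; omega) (by simp; omega) ?_)
    (sum_sum_ite_eq_zero ?_) (sum_sum_ite_eq_zero ?_) (if_neg (by simp))
  · simpa using key
  · simp
  · intro s' hs' t' ht'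
    simp only [Prod.mk.injEq, intervalDegree_eq_iff hts (Finset.mem_Ioo.1 ht').2, single_one_inj]
    tauto
  · intro s' hs' t' ht'
    simp only [Prod.mk.injEq, intervalDegree_eq_iff hts (Finset.mem_range.1 ht'), single_one_inj]
    omega
  · simp

theorem entrySum_bm_mul_WmProd_eq_zero (h : alphaPoly L n Ψb ΨW Φst Φb ΦWb ΦbW ΦWW Φ1 = 0)
    {s t : ℕ} (hs : 0 < s) (hsL : s ≤ L) (ht : t < L)
    (hst : s ≠ t) : entrySum (ΦbW s t) (bm n s * toR (Ψb s t) * WmProd n L t) = 0 := by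
  classical
  have key := component_sum_eq_zero h (intervalDegree t L, Pi.single s 1)
    (sum_sum_ite_eq_zero ?_)
    (Finset.sum_eq_zero fun i _ => if_neg (by simp [intervalDegree_ne_zero ht]))
    (sum_sum_ite_eq_zero ?_)
    (sum_sum_ite_eq_single (s₀ := s) (t₀ := t) (by simp; omega) (by simpa) ?_)
    (sum_sum_ite_eq_zero ?_) (if_neg (by simp))
  · simpa using key
  · simp
  · intro s' hs' t' ht'
    simp only [Prod.mk.injEq, intervalDegree_eq_iff ht (Finset.mem_Ioo.1 ht').2, single_one_inj]
    omega
  · intro s' hs' t' ht'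
    simp only [Prod.mk.injEq, intervalDegree_eq_iff ht (Finset.mem_range.1 ht'), single_one_inj]
    tauto
  · simp

theorem columnSum_add_entrySum_eq_zero (h : alphaPoly L n Ψb ΨW Φst Φb ΦWb ΦbW ΦWW Φ1 = 0)
    {t : ℕ} (ht : 0 < t) (htL : t < L) :
    columnSum (ΦWb L t) (WmProd n L t * bm n t)
      + entrySum (ΦbW t t) (bm n t * toR (Ψb t t) * WmProd n L t) = 0 := by
  classical
  have key := component_sum_eq_zero h (intervalDegree t L, Pi.single t 1)
    (sum_sum_ite_eq_zero ?_)
    (Finset.sum_eq_zero fun i _ => if_neg (by simp [intervalDegree_ne_zero htL]))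
    (sum_sum_ite_eq_single (s₀ := L) (t₀ := t) (by simp; omega) (by simp; omega) ?_)
    (sum_sum_ite_eq_single (s₀ := t) (t₀ := t) (by simp; omega) (by simpa) ?_)
    (sum_sum_ite_eq_zero ?_) (if_neg (by simp))
  · simpa using key
  · simp
  · intro s' hs' t' ht'
    simp only [Prod.mk.injEq, intervalDegree_eq_iff htL (Finset.mem_Ioo.1 ht').2, single_one_inj]
    tauto
  · intro s' hs' t' ht'
    simp only [Prod.mk.injEq, intervalDegree_eq_iff htL (Finset.mem_range.1 ht'), single_one_inj]
    tauto
  · simp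

theorem columnSum_bm_eq_zero (h : alphaPoly L n Ψb ΨW Φst Φb ΦWb ΦbW ΦWW Φ1 = 0)
    {s : ℕ} (hs : 0 < s) (hsL : s ≤ L) :
    columnSum (Φb s) (bm n s) = 0 := by
  classical
  have hs₀ : s ∈ Finset.Icc 1 L := Finset.mem_Icc.2 ⟨hs, hsL⟩
  have key := component_sum_eq_zero h (0, Pi.single s 1)
    (sum_sum_ite_eq_zero ?_)
    ((Finset.sum_eq_single_of_mem s hs₀ fun i _ hi => if_neg ?_).trans (if_pos rfl))
    (sum_sum_ite_eq_zero ?_) (sum_sum_ite_eq_zero ?_)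
    (sum_sum_ite_eq_zero ?_) (if_neg (by simp))
  · simpa using key
  · simp
  · simpa [single_one_inj] using hi
  · intro s' hs' t' ht' e
    exact intervalDegree_ne_zero (Finset.mem_Ioo.1 ht').2 (Prod.ext_iff.1 e).1.symm
  · intro s' hs' t' ht' e
    exact intervalDegree_ne_zero (Finset.mem_range.1 ht') (Prod.ext_iff.1 e).1.symm
  · simp

theorem coeff_one_eq_zero (h : alphaPoly L n Ψb ΨW Φst Φb ΦWb ΦbW ΦWW Φ1 = 0) :
    Φ1 = 0 := by
  classical
  have key := component_sum_eq_zero h 0 (sum_sum_ite_eq_zero ?_)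
    (Finset.sum_eq_zero fun i _ => if_neg (by simp [Prod.ext_iff, eq_comm]))
    (sum_sum_ite_eq_zero ?_) (sum_sum_ite_eq_zero ?_) (sum_sum_ite_eq_zero ?_) (if_pos rfl)
  · simpa using key
  · intro s' hs' t' ht' e
    exact intervalDegree_ne_zero (Finset.mem_range.1 ht') (Prod.ext_iff.1 e).1.symm
  · intro s' hs' t' ht' e
    exact intervalDegree_ne_zero (Finset.mem_Ioo.1 ht').2 (Prod.ext_iff.1 e).1.symm
  · intro s' hs' t' ht' e
    exact intervalDegree_ne_zero (Finset.mem_range.1 ht') (Prod.ext_iff.1 e).1.symm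
  · intro s' hs' t' ht' e
    exact intervalDegree_ne_zero (Finset.mem_Icc.1 hs').1
      (add_eq_zero.1 (Prod.ext_iff.1 e).1.symm).1

end Component

/-- The substitution `x^(i)_{jk} ↦ u^(i)_j v^(i)_k`, `y^(i)_j ↦ z^(i)_j`, which makes every
weight matrix of rank one. The indeterminates `u`, `v`, `z` are those with first index
`0`, `1`, `2`. -/
def rankOneSubst : Rpoly →ₐ[ℝ] MvPolynomial (ℕ × ℕ × ℕ) ℝ :=
  aeval fun
    | Sum.inl (i, j, k) => X (0, i, j) * X (1, i, k)
    | Sum.inr (i, j) => X (2, i, j)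

theorem rankOneSubst_C (r : ℝ) : rankOneSubst (C r) = C r := by
  simp [rankOneSubst]

theorem rankOneSubst_Wm (n : ℕ → ℕ) (i : ℕ) (p : Fin (n i)) (q : Fin (n (i - 1))) :
    rankOneSubst (Wm n i p q) = X (0, i, (p : ℕ)) * X (1, i, (q : ℕ)) := by
  simp [rankOneSubst, Wm]

theorem rankOneSubst_bm (n : ℕ → ℕ) (i : ℕ) (p : Fin (n i)) (q : Fin 1) :
    rankOneSubst (bm n i p q) = X (2, i, (p : ℕ)) := by
  simp [rankOneSubst, bm]

theorem sum_X_mul_X_ne_zero {N : ℕ} (hN : 1 ≤ N) (i j k l : ℕ) :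
    (∑ m : Fin N, X (i, j, (m : ℕ)) * X (k, l, (m : ℕ)) : MvPolynomial (ℕ × ℕ × ℕ) ℝ) ≠ 0 := by
  intro e
  have := congrArg (eval fun _ => (1 : ℝ)) e
  simp at this
  omega

theorem eq_zero_of_sum_C_mul_X {N i j : ℕ} {D : Fin N → ℝ}
    (h : (∑ m, C (D m) * X (i, j, (m : ℕ)) : MvPolynomial (ℕ × ℕ × ℕ) ℝ) = 0) : D = 0 := by
  funext m
  have := congrArg (eval fun x : ℕ × ℕ × ℕ => if x.2.2 = m then (1 : ℝ) else 0) h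
  simpa [Fin.val_inj] using this

theorem eq_zero_of_sum_C_mul_X_mul_X {M N i j k l : ℕ} (hik : i ≠ k) {D : Fin M → Fin N → ℝ}
    (h : (∑ p, ∑ q, C (D p q) * (X (i, j, (p : ℕ)) * X (k, l, (q : ℕ))) :
      MvPolynomial (ℕ × ℕ × ℕ) ℝ) = 0) : D = 0 := by
  funext p q
  have := congrArg (eval fun x : ℕ × ℕ × ℕ =>
    if x.1 = i then (if x.2.2 = p then (1 : ℝ) else 0)
    else (if x.2.2 = q then (1 : ℝ) else 0)) h
  simpa [Fin.val_inj, hik.symm] using this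

theorem exists_rankOneSubst_WmProd {n : ℕ → ℕ} (hn : ∀ i, 1 ≤ n i) {s t : ℕ} (h : t < s) :
    ∃ c : MvPolynomial (ℕ × ℕ × ℕ) ℝ, c ≠ 0 ∧ ∀ p q,
      rankOneSubst (WmProd n s t p q) = c * (X (0, s, (p : ℕ)) * X (1, t + 1, (q : ℕ))) := by
  replace h : t + 1 ≤ s := h
  induction s, h using Nat.le_induction with
  | base =>
    refine ⟨1, one_ne_zero, fun p q => ?_⟩
    rw [WmProd_succ_apply n le_rfl, WmProd_self, one_mul, ← rankOneSubst_Wm n (t + 1) p q]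
    simp [Matrix.one_apply]
  | succ s hs ih =>
    obtain ⟨c, hc, ih⟩ := ih
    refine ⟨c * ∑ m : Fin (n s), X (1, s + 1, (m : ℕ)) * X (0, s, (m : ℕ)),
      mul_ne_zero hc (sum_X_mul_X_ne_zero (hn s) _ _ _ _), fun p q => ?_⟩
    rw [WmProd_succ_apply n (Nat.le_of_succ_le hs), map_sum]
    simp only [Finset.mul_sum, Finset.sum_mul]
    refine Finset.sum_congr rfl fun m _ => ?_
    rw [map_mul, ih, show rankOneSubst (Wm n (s + 1) p m) = _ from rankOneSubst_Wm n (s + 1) p m]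
    ring

theorem eq_zero_of_entrySum_WmProd {n : ℕ → ℕ} (hn : ∀ i, 1 ≤ n i) {s t : ℕ} (h : t < s)
    {D : Fin (n s) → Fin (n t) → ℝ} (hD : entrySum D (WmProd n s t) = 0) : D = 0 := by
  obtain ⟨c, hc, hW⟩ := exists_rankOneSubst_WmProd hn h
  refine eq_zero_of_sum_C_mul_X_mul_X (i := 0) (k := 1) (j := s) (l := t + 1) zero_ne_one
    (((mul_eq_zero (a := c)).1 ?_).resolve_left hc)
  rw [← map_zero rankOneSubst, ← hD]
  simp only [entrySum, map_sum, map_mul, rankOneSubst_C, hW, Finset.mul_sum]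
  exact Finset.sum_congr rfl fun p _ => Finset.sum_congr rfl fun q _ => by ring

theorem eq_zero_of_columnSum_bm {n : ℕ → ℕ} {s : ℕ} {D : Fin (n s) → ℝ}
    (hD : columnSum D (bm n s) = 0) : D = 0 := by
  refine eq_zero_of_sum_C_mul_X (i := 2) (j := s) ?_
  rw [← map_zero rankOneSubst, ← hD]
  simp only [columnSum, map_sum, map_mul, rankOneSubst_C, rankOneSubst_bm]

theorem eq_zero_of_columnSum_WmProd_mul_bm {n : ℕ → ℕ} (hn : ∀ i, 1 ≤ n i) {s t : ℕ} (h : t < s)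
    {D : Fin (n s) → ℝ} (hD : columnSum D (WmProd n s t * bm n t) = 0) : D = 0 := by
  obtain ⟨c, hc, hW⟩ := exists_rankOneSubst_WmProd hn h
  refine eq_zero_of_sum_C_mul_X (i := 0) (j := s) (((mul_eq_zero
    (a := c * ∑ m : Fin (n t), X (1, t + 1, (m : ℕ)) * X (2, t, (m : ℕ)))).1 ?_).resolve_left
      (mul_ne_zero hc (sum_X_mul_X_ne_zero (hn t) _ _ _ _)))
  rw [← map_zero rankOneSubst, ← hD]
  simp only [columnSum, Matrix.mul_apply, map_sum, map_mul, rankOneSubst_C, rankOneSubst_bm, hW,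
    Finset.mul_sum, Finset.sum_mul]
  refine Finset.sum_congr rfl fun p _ => Finset.sum_congr rfl fun m _ => by ring

theorem eq_zero_of_entrySum_bm_mul_WmProd {n : ℕ → ℕ} (hn : ∀ i, 1 ≤ n i) {L s t : ℕ}
    (h : t < L) {A : Matrix (Fin 1) (Fin (n L)) ℝ} {D : Fin (n s) → Fin (n t) → ℝ}
    (hD : entrySum D (bm n s * toR A * WmProd n L t) = 0) : D = 0 ∨ A = 0 := by
  obtain ⟨c, hc, hW⟩ := exists_rankOneSubst_WmProd hn h
  have entry : ∀ p q, rankOneSubst ((bm n s * toR A * WmProd n L t) p q) =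
      c * (∑ m, C (A 0 m) * X (0, L, (m : ℕ))) *
        (X (2, s, (p : ℕ)) * X (1, t + 1, (q : ℕ))) := fun p q => by
    simp only [Matrix.mul_apply, map_sum, map_mul, rankOneSubst_C, rankOneSubst_bm, hW,
      Finset.mul_sum, Finset.sum_mul, toR, Matrix.map_apply, Fin.sum_univ_one]
    exact Finset.sum_congr rfl fun m _ => by ring
  have key : c * ((∑ p, ∑ q, C (D p q) * (X (2, s, (p : ℕ)) * X (1, t + 1, (q : ℕ)))) *
      ∑ m, C (A 0 m) * X (0, L, (m : ℕ))) = 0 := by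
    rw [mul_left_comm, mul_comm, ← map_zero rankOneSubst, ← hD]
    simp only [entrySum, map_sum, map_mul, rankOneSubst_C, entry]
    simp only [Finset.mul_sum (s := (Finset.univ : Finset (Fin (n s)))),
      Finset.mul_sum (s := (Finset.univ : Finset (Fin (n t))))]
    exact Finset.sum_congr rfl fun p _ => Finset.sum_congr rfl fun q _ => by ring
  refine (mul_eq_zero.1 ((mul_eq_zero.1 key).resolve_left hc)).imp
    (eq_zero_of_sum_C_mul_X_mul_X (by decide)) fun e => ?_
  ext i m
  rw [Subsingleton.elim i 0]
  exact congrFun (eq_zero_of_sum_C_mul_X e) m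

theorem eq_zero_of_entrySum_WmProd_mul_WmProd {n : ℕ → ℕ} (hn : ∀ i, 1 ≤ n i) {L s t : ℕ}
    (hs : 0 < s) (h : t < L) {A : Matrix (Fin (n 0)) (Fin (n L)) ℝ} {D : Fin (n s) → Fin (n t) → ℝ}
    (hD : entrySum D (WmProd n s 0 * toR A * WmProd n L t) = 0) : D = 0 ∨ A = 0 := by
  obtain ⟨c, hc, hW⟩ := exists_rankOneSubst_WmProd hn h
  obtain ⟨c', hc', hW'⟩ := exists_rankOneSubst_WmProd hn hs
  have entry : ∀ p q, rankOneSubst ((WmProd n s 0 * toR A * WmProd n L t) p q) =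
      c * c' * (∑ l, ∑ m, C (A l m) * (X (1, 0 + 1, (l : ℕ)) * X (0, L, (m : ℕ)))) *
        (X (0, s, (p : ℕ)) * X (1, t + 1, (q : ℕ))) := fun p q => by
    simp only [Matrix.mul_apply, map_sum, map_mul, rankOneSubst_C, hW, hW',
      Finset.mul_sum, Finset.sum_mul, toR, Matrix.map_apply]
    rw [Finset.sum_comm]
    exact Finset.sum_congr rfl fun l _ => Finset.sum_congr rfl fun m _ => by ring
  have key : c * c' * ((∑ p, ∑ q, C (D p q) * (X (0, s, (p : ℕ)) * X (1, t + 1, (q : ℕ)))) *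
      ∑ l, ∑ m, C (A l m) * (X (1, 0 + 1, (l : ℕ)) * X (0, L, (m : ℕ)))) = 0 := by
    rw [mul_left_comm, mul_comm, ← map_zero rankOneSubst, ← hD]
    simp only [entrySum, map_sum, map_mul, rankOneSubst_C, entry]
    simp only [Finset.mul_sum (s := (Finset.univ : Finset (Fin (n s)))),
      Finset.mul_sum (s := (Finset.univ : Finset (Fin (n t))))]
    exact Finset.sum_congr rfl fun p _ => Finset.sum_congr rfl fun q _ => by ring
  exact (mul_eq_zero.1 ((mul_eq_zero.1 key).resolve_left (mul_ne_zero hc hc'))).imp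
    (eq_zero_of_sum_C_mul_X_mul_X (by decide)) (eq_zero_of_sum_C_mul_X_mul_X (by decide))

/-- if two coefficient collections give the same polynomial `α(·, Ψ)`,
then their coefficients agree as described. -/
theorem alphaPoly_coeff_comparison (L : ℕ) (hL : 1 ≤ L) (n : ℕ → ℕ) (hn : ∀ i, 1 ≤ n i)
    (Ψb : ∀ _s _t : ℕ, Matrix (Fin 1) (Fin (n L)) ℝ)
    (ΨW : ∀ _s _t : ℕ, Matrix (Fin (n 0)) (Fin (n L)) ℝ)
    (Φst Φst' : ∀ s t : ℕ, Fin (n s) → Fin (n t) → ℝ)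
    (Φb Φb' : ∀ s : ℕ, Fin (n s) → ℝ)
    (ΦWb ΦWb' : ∀ s _t : ℕ, Fin (n s) → ℝ)
    (ΦbW ΦbW' : ∀ s t : ℕ, Fin (n s) → Fin (n t) → ℝ)
    (ΦWW ΦWW' : ∀ s t : ℕ, Fin (n s) → Fin (n t) → ℝ)
    (Φ1 Φ1' : ℝ)
    (h : alphaPoly L n Ψb ΨW Φst Φb ΦWb ΦbW ΦWW Φ1
        = alphaPoly L n Ψb ΨW Φst' Φb' ΦWb' ΦbW' ΦWW' Φ1') :
    -- (1)
    (∀ s t : ℕ, t < s → s ≤ L → ¬(s = L ∧ t = 0) → ∀ p q, Φst s t p q = Φst' s t p q) ∧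
    -- (2)
    (∀ s t : ℕ, 0 < s → s ≤ L → t < L → s ≠ t →
      (∀ p q, ΦWW s t p q = ΦWW' s t p q) ∨ ΨW s t = 0) ∧
    -- (3)
    ((∑ p, ∑ q, MvPolynomial.C (Φst L 0 p q) * (WmProd n L 0) p q)
      + (∑ s ∈ Finset.Ioo 0 L, ∑ p, ∑ q, MvPolynomial.C (ΦWW s s p q) *
          (WmProd n s 0 * toR (ΨW s s) * WmProd n L s) p q)
      = (∑ p, ∑ q, MvPolynomial.C (Φst' L 0 p q) * (WmProd n L 0) p q)
      + (∑ s ∈ Finset.Ioo 0 L, ∑ p, ∑ q, MvPolynomial.C (ΦWW' s s p q) *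
          (WmProd n s 0 * toR (ΨW s s) * WmProd n L s) p q)) ∧
    -- (4)
    (∀ s t : ℕ, s < L → t < s → 0 < t → ∀ p, ΦWb s t p = ΦWb' s t p) ∧
    -- (5)
    (∀ s t : ℕ, 0 < s → s ≤ L → t < L → s ≠ t →
      (∀ p q, ΦbW s t p q = ΦbW' s t p q) ∨ Ψb s t = 0) ∧
    -- (6)
    (∀ t : ℕ, 0 < t → t < L →
      (∑ p, MvPolynomial.C (ΦWb L t p) * (WmProd n L t * bm n t) p 0)
        + (∑ p, ∑ q, MvPolynomial.C (ΦbW t t p q) *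
            (bm n t * toR (Ψb t t) * WmProd n L t) p q)
      = (∑ p, MvPolynomial.C (ΦWb' L t p) * (WmProd n L t * bm n t) p 0)
        + (∑ p, ∑ q, MvPolynomial.C (ΦbW' t t p q) *
            (bm n t * toR (Ψb t t) * WmProd n L t) p q)) ∧
    -- (7)
    (∀ s : ℕ, 0 < s → s ≤ L → ∀ p, Φb s p = Φb' s p) ∧
    -- (8)
    (Φ1 = Φ1') := by
  have h₀ := (alphaPoly_sub L n Ψb ΨW Φst Φst' Φb Φb' ΦWb ΦWb' ΦbW ΦbW' ΦWW ΦWW' Φ1 Φ1').trans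
    (sub_eq_zero.2 h)
  refine ⟨fun s t hts hsL hne p q => ?_, fun s t hs hsL ht hst => ?_, ?_,
    fun s t hsL hts ht p => ?_, fun s t hs hsL ht hst => ?_, fun t ht htL => ?_,
    fun s hs hsL p => ?_, ?_⟩
  · exact sub_eq_zero.1 (congrFun (congrFun (eq_zero_of_entrySum_WmProd hn hts
      (entrySum_WmProd_eq_zero h₀ hts hsL hne)) p) q)
  · exact (eq_zero_of_entrySum_WmProd_mul_WmProd hn hs ht
      (entrySum_WmProd_mul_WmProd_eq_zero h₀ hs hsL ht hst)).imp_left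
      fun e p q => sub_eq_zero.1 (congrFun (congrFun e p) q)
  · have key := entrySum_full_add_sum_eq_zero h₀ hL
    simp only [entrySum, Pi.sub_apply, map_sub, sub_mul, Finset.sum_sub_distrib] at key
    linear_combination key
  · exact sub_eq_zero.1 (congrFun (eq_zero_of_columnSum_WmProd_mul_bm hn hts
      (columnSum_WmProd_mul_bm_eq_zero h₀ hsL hts ht)) p)
  · exact (eq_zero_of_entrySum_bm_mul_WmProd hn ht
      (entrySum_bm_mul_WmProd_eq_zero h₀ hs hsL ht hst)).imp_left
      fun e p q => sub_eq_zero.1 (congrFun (congrFun e p) q)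
  · have key := columnSum_add_entrySum_eq_zero h₀ ht htL
    simp only [columnSum, entrySum, Pi.sub_apply, map_sub, sub_mul, Finset.sum_sub_distrib] at key
    linear_combination key
  · exact sub_eq_zero.1 (congrFun (eq_zero_of_columnSum_bm (columnSum_bm_eq_zero h₀ hs hsL)) p)
  · exact sub_eq_zero.1 (coeff_one_eq_zero h₀)
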